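/- For all constants c and D the following holds: on the class of connected graphs of diameter at most D whose vertices carry distinct identifiers and which contain at least one vertex whose identifier is at most c, the property AMOS admits a 1-local proof-labeling scheme of size O(log D) (the hidden constant depending only on c). -/

import Mathlib

open SimpleGraph Filter

/-- A network configuration: a finite connected simple graph whose vertices carry
an input bit (`sel`, "selected") and distinct identifiers (`ids`). -/
structure Network where
  n : ℕ
  G : SimpleGraph (Fin n)
  conn : G.Connected
  sel : Fin n → Bool
  ids : Fin n → ℕ
  ids_inj : Function.Injective ids

/-- AMOS: at most one vertex is selected. -/
def Network.AMOS (N : Network) : Prop :=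
  ∀ u v : Fin N.n, N.sel u = true → N.sel v = true → u = v

/-- The radius-`r` ball around `v`. -/
def Network.ball (N : Network) (r : ℕ) (v : Fin N.n) : Set (Fin N.n) :=
  {u : Fin N.n | N.G.dist v u ≤ r}

lemma Network.center_mem_ball (N : Network) (r : ℕ) (v : Fin N.n) :
    v ∈ N.ball r v := by
  simp [Network.ball, SimpleGraph.dist_self]

/-- A verifier: at each vertex of each network, given certificates (bit strings),
it accepts (`true`) or rejects (`false`). -/
def Verifier : Type :=
  ∀ N : Network, (Fin N.n → List Bool) → Fin N.n → Bool

/-- `r`-locality: the decision at `v` only depends on the radius-`r` ball around `v`,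
i.e. on the subgraph induced by the vertices at distance at most `r` from `v`,
together with the input bits, the identifiers and the certificates in the ball. -/
def IsLocalVerifier (r : ℕ) (A : Verifier) : Prop :=
  ∀ (N N' : Network) (P : Fin N.n → List Bool) (P' : Fin N'.n → List Bool)
    (v : Fin N.n) (v' : Fin N'.n)
    (φ : (N.G.induce (N.ball r v)) ≃g (N'.G.induce (N'.ball r v'))),
    (∀ x : N.ball r v, N.sel x.1 = N'.sel (φ x).1) →
    (∀ x : N.ball r v, N.ids x.1 = N'.ids (φ x).1) →
    (∀ x : N.ball r v, P x.1 = P' (φ x).1) →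
    φ ⟨v, N.center_mem_ball r v⟩ = ⟨v', N'.center_mem_ball r v'⟩ →
    A N P v = A N' P' v'

/-- An `r`-local proof-labeling scheme of size `size` for the property `Pr`
on the class of networks `Net`: a prover assigning certificates of at most
`size n` bits on yes-instances (completeness), such that on no-instances every
certificate assignment is rejected at some vertex (soundness). -/
structure PLS (r : ℕ) (size : ℕ → ℕ) (Net : Network → Prop) (Pr : Network → Prop) where
  prover : ∀ N : Network, Fin N.n → List Bool
  verifier : Verifier
  verifier_local : IsLocalVerifier r verifier
  prover_size : ∀ N : Network, Net N → Pr N → ∀ v, (prover N v).length ≤ size N.n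
  completeness : ∀ N : Network, Net N → Pr N → ∀ v, verifier N (prover N) v = true
  soundness : ∀ N : Network, Net N → ¬ Pr N →
    ∀ P : Fin N.n → List Bool, ∃ v, verifier N P v = false

/-- The number whose binary expansion is a given bit string (unspecified if there is none). -/
noncomputable def certNat (l : List Bool) : ℕ := Function.invFun Nat.bits l

lemma nat_bits_injective : Function.Injective Nat.bits := by
  intro a b h
  induction a using Nat.binaryRec' generalizing b with
  | zero =>
    by_contra hb
    have h1 := Nat.size_eq_bits_len b
    rw [← h] at h1
    have h2 := Nat.size_pos.2 (Nat.pos_of_ne_zero (Ne.symm hb))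
    simp at h1
    omega
  | bit x n hx ih =>
    induction b using Nat.binaryRec' with
    | zero => rw [Nat.bits_append_bit _ _ hx] at h; simp at h
    | bit y m hy _ =>
      rw [Nat.bits_append_bit _ _ hx, Nat.bits_append_bit _ _ hy] at h
      obtain ⟨rfl, htail⟩ := List.cons.inj h
      rw [ih htail]

lemma certNat_bits (m : ℕ) : certNat m.bits = m :=
  Function.leftInverse_invFun nat_bits_injective m

/-- The root identifier claimed by a certificate. -/
noncomputable def certRoot (c : ℕ) (l : List Bool) : ℕ := certNat l % (c + 1)

/-- The mark of a certificate: `0` off the path, `k + 1` at the vertex of the path at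
distance `k` from the root. -/
noncomputable def certMark (c : ℕ) (l : List Bool) : ℕ := certNat l / (c + 1)

/-- The certificate with given root identifier and mark. -/
def mkCert (c i t : ℕ) : List Bool := (i + (c + 1) * t).bits

lemma certRoot_mkCert {c i : ℕ} (hi : i ≤ c) (t : ℕ) : certRoot c (mkCert c i t) = i := by
  rw [certRoot, mkCert, certNat_bits, Nat.add_mul_mod_self_left, Nat.mod_eq_of_lt (by omega)]

lemma certMark_mkCert {c i : ℕ} (hi : i ≤ c) (t : ℕ) : certMark c (mkCert c i t) = t := by
  rw [certMark, mkCert, certNat_bits, Nat.add_mul_div_left _ _ (by omega),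
    Nat.div_eq_of_lt (by omega), zero_add]

lemma length_mkCert_le {c i t D : ℕ} (hi : i ≤ c) (ht : t ≤ D + 1) :
    (mkCert c i t).length ≤ (c + 3) * (Nat.log 2 D + 1) := by
  rw [mkCert, Nat.size_eq_bits_len]
  have h1 : D < 2 ^ (Nat.log 2 D + 1) := Nat.lt_pow_succ_log_self (by norm_num) D
  have h2 : c + 1 < 2 ^ (c + 1) := Nat.lt_two_pow_self
  have h3 : 1 ≤ 2 ^ (Nat.log 2 D + 1) := Nat.one_le_two_pow
  have h4 : i + (c + 1) * t < 2 ^ ((c + 1) + (Nat.log 2 D + 1 + 1)) := by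
    rw [pow_add, pow_succ 2 (Nat.log 2 D + 1)]
    calc i + (c + 1) * t < (c + 1) * (t + 1) := by rw [mul_add]; omega
      _ ≤ 2 ^ (c + 1) * (2 ^ (Nat.log 2 D + 1) * 2) := Nat.mul_le_mul h2.le (by omega)
  refine (Nat.size_le.2 h4).trans ?_
  nlinarith [Nat.zero_le (c * Nat.log 2 D)]

/-- The local check at `v`: neighbours agree on the root identifier, a selected vertex lies on
the marked path and is its end, only the root has mark `1`, and every other marked vertex has
a marked predecessor and at most one marked successor. -/
structure LocallyValid (c : ℕ) (N : Network) (P : Fin N.n → List Bool) (v : Fin N.n) : Prop where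
  root_eq : ∀ u, N.G.Adj v u → certRoot c (P u) = certRoot c (P v)
  marked : N.sel v = true → certMark c (P v) ≠ 0
  ids_eq : certMark c (P v) = 1 → N.ids v = certRoot c (P v)
  pred : ∀ k, certMark c (P v) = k + 2 → ∃ u, N.G.Adj v u ∧ certMark c (P u) = k + 1
  succ_unique : certMark c (P v) ≠ 0 → ∀ u w, N.G.Adj v u → N.G.Adj v w →
    certMark c (P u) = certMark c (P v) + 1 → certMark c (P w) = certMark c (P v) + 1 → u = w
  sel_last : certMark c (P v) ≠ 0 → N.sel v = true → ∀ u, N.G.Adj v u →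
    certMark c (P u) ≠ certMark c (P v) + 1

lemma Network.adj_mem_ball_one {N : Network} {u v : Fin N.n} (h : N.G.Adj v u) :
    u ∈ N.ball 1 v :=
  (SimpleGraph.dist_eq_one_iff_adj.2 h).le

lemma LocallyValid.of_iso {c : ℕ} {N N' : Network} {P : Fin N.n → List Bool}
    {P' : Fin N'.n → List Bool} {v : Fin N.n} {v' : Fin N'.n}
    (φ : (N.G.induce (N.ball 1 v)) ≃g (N'.G.induce (N'.ball 1 v')))
    (hsel : ∀ x : N.ball 1 v, N.sel x.1 = N'.sel (φ x).1)
    (hids : ∀ x : N.ball 1 v, N.ids x.1 = N'.ids (φ x).1)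
    (hP : ∀ x : N.ball 1 v, P x.1 = P' (φ x).1)
    (hv : φ ⟨v, N.center_mem_ball 1 v⟩ = ⟨v', N'.center_mem_ball 1 v'⟩)
    (h : LocallyValid c N P v) : LocallyValid c N' P' v' := by
  have hsel' : N.sel v = N'.sel v' := by simpa [hv] using hsel ⟨v, N.center_mem_ball 1 v⟩
  have hids' : N.ids v = N'.ids v' := by simpa [hv] using hids ⟨v, N.center_mem_ball 1 v⟩
  have hP' : P v = P' v' := by simpa [hv] using hP ⟨v, N.center_mem_ball 1 v⟩
  have push : ∀ u, N.G.Adj v u → ∃ u', N'.G.Adj v' u' ∧ P u = P' u' := by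
    intro u hu
    refine ⟨_, ?_, hP ⟨u, Network.adj_mem_ball_one hu⟩⟩
    have := φ.map_adj_iff (v := ⟨v, N.center_mem_ball 1 v⟩)
      (w := ⟨u, Network.adj_mem_ball_one hu⟩)
    rw [hv] at this
    exact this.2 hu
  have pull : ∀ u', N'.G.Adj v' u' →
      ∃ x : N.ball 1 v, (φ x).1 = u' ∧ N.G.Adj v x.1 ∧ P x.1 = P' u' := by
    intro u' hu'
    obtain ⟨x, hx⟩ := φ.surjective ⟨u', Network.adj_mem_ball_one hu'⟩
    have hx' : (φ x).1 = u' := by rw [hx]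
    refine ⟨x, hx', ?_, by rw [hP, hx']⟩
    have := φ.map_adj_iff (v := ⟨v, N.center_mem_ball 1 v⟩) (w := x)
    rw [hv, hx] at this
    exact this.1 hu'
  obtain ⟨h1, h2, h3, h4, h5, h6⟩ := h
  rw [hP'] at h1 h2 h3 h4 h5 h6
  rw [hsel'] at h2 h6
  rw [hids'] at h3
  refine ⟨?_, h2, h3, ?_, ?_, ?_⟩
  · intro u' hu'
    obtain ⟨x, -, hx, hxP⟩ := pull u' hu'
    rw [← hxP]
    exact h1 _ hx
  · intro k hk
    obtain ⟨u, hu, huk⟩ := h4 k hk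
    obtain ⟨u', hu', e⟩ := push u hu
    exact ⟨u', hu', by rw [← e, huk]⟩
  · intro h0 u' w' hu' hw' eu ew
    obtain ⟨x, rfl, hx, hxP⟩ := pull u' hu'
    obtain ⟨y, rfl, hy, hyP⟩ := pull w' hw'
    rw [← hxP] at eu
    rw [← hyP] at ew
    rw [Subtype.ext (h5 h0 _ _ hx hy eu ew)]
  · intro h0 hs u' hu'
    obtain ⟨x, -, hx, hxP⟩ := pull u' hu'
    rw [← hxP]
    exact h6 h0 hs _ hx

lemma certRoot_eq_of_locallyValid {c : ℕ} {N : Network} {P : Fin N.n → List Bool}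
    (h : ∀ v, LocallyValid c N P v) (u v : Fin N.n) : certRoot c (P u) = certRoot c (P v) := by
  obtain ⟨p⟩ := N.conn.preconnected u v
  induction p with
  | nil => rfl
  | cons hadj _ ih => rw [← ih, (h _).root_eq _ hadj]

lemma eq_of_certMark_eq {c : ℕ} {N : Network} {P : Fin N.n → List Bool}
    (h : ∀ v, LocallyValid c N P v) (k : ℕ) (u v : Fin N.n) (hu : certMark c (P u) = k + 1)
    (hv : certMark c (P v) = k + 1) : u = v := by
  induction k generalizing u v with
  | zero =>
    apply N.ids_inj
    rw [(h u).ids_eq hu, (h v).ids_eq hv, certRoot_eq_of_locallyValid h]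
  | succ k ih =>
    obtain ⟨u', hu', eu⟩ := (h u).pred k hu
    obtain ⟨v', hv', ev⟩ := (h v).pred k hv
    obtain rfl := ih u' v' eu ev
    exact (h u').succ_unique (by omega) u v hu'.symm hv'.symm (by omega) (by omega)

lemma exists_certMark_eq {c : ℕ} {N : Network} {P : Fin N.n → List Bool}
    (h : ∀ v, LocallyValid c N P v) (j k : ℕ) (v : Fin N.n) (hv : certMark c (P v) = k + j + 1) :
    ∃ u, certMark c (P u) = k + 1 := by
  induction j generalizing v with
  | zero => exact ⟨v, hv⟩
  | succ j ih =>
    obtain ⟨u, -, hu⟩ := (h v).pred (k + j) (by omega)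
    exact ih u hu

lemma not_certMark_lt_of_sel {c : ℕ} {N : Network} {P : Fin N.n → List Bool}
    (h : ∀ v, LocallyValid c N P v) (u v : Fin N.n) (hu : N.sel u = true) :
    ¬ certMark c (P u) < certMark c (P v) := by
  intro hlt
  have hu0 := (h u).marked hu
  obtain ⟨w, hw⟩ := exists_certMark_eq h (certMark c (P v) - certMark c (P u) - 1)
    (certMark c (P u)) v (by omega)
  obtain ⟨w', hw', e⟩ := (h w).pred (certMark c (P u) - 1) (by omega)
  obtain rfl := eq_of_certMark_eq h (certMark c (P u) - 1) w' u e (by omega)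
  exact (h w').sel_last hu0 hu w hw'.symm hw

lemma amos_of_locallyValid {c : ℕ} {N : Network} {P : Fin N.n → List Bool}
    (h : ∀ v, LocallyValid c N P v) : N.AMOS := by
  intro u v hu hv
  have h1 := not_certMark_lt_of_sel h u v hu
  have h2 := not_certMark_lt_of_sel h v u hv
  have h3 := (h u).marked hu
  exact eq_of_certMark_eq h (certMark c (P u) - 1) u v (by omega) (by omega)

lemma exists_geodesic {V : Type*} {G : SimpleGraph V} (hG : G.Connected) (r s : V) :
    ∃ p : ℕ → V, p (G.dist r s) = s ∧ (∀ k < G.dist r s, G.Adj (p k) (p (k + 1))) ∧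
      ∀ k ≤ G.dist r s, G.dist r (p k) = k := by
  obtain ⟨w, hw⟩ := hG.exists_walk_length_eq_dist r s
  refine ⟨w.getVert, by rw [← hw, w.getVert_length], fun k hk => ?_, fun k hk => ?_⟩
  · exact w.adj_getVert_succ (by omega)
  · have h1 := SimpleGraph.dist_le (w.take k)
    have h2 := SimpleGraph.dist_le (w.drop k)
    have h3 := hG.dist_triangle (u := r) (v := w.getVert k) (w := s)
    rw [SimpleGraph.Walk.take_length] at h1
    rw [SimpleGraph.Walk.drop_length] at h2
    omega

lemma exists_certificate {c D : ℕ} (N : Network) (hD : ∀ u v : Fin N.n, N.G.dist u v ≤ D)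
    (hc : ∃ v : Fin N.n, N.ids v ≤ c) (hN : N.AMOS) :
    ∃ P : Fin N.n → List Bool, (∀ v, (P v).length ≤ (c + 3) * (Nat.log 2 D + 1)) ∧
      ∀ v, LocallyValid c N P v := by
  classical
  obtain ⟨r, hr⟩ := hc
  by_cases hs : ∃ s, N.sel s = true
  · obtain ⟨s, hs⟩ := hs
    obtain ⟨p, hps, hadj, hdist⟩ := exists_geodesic N.conn r s
    let t : Fin N.n → ℕ := fun v =>
      if ∃ k ≤ N.G.dist r s, p k = v then N.G.dist r v + 1 else 0
    have htp : ∀ k ≤ N.G.dist r s, t (p k) = k + 1 := by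
      intro k hk
      simp only [t]
      rw [if_pos ⟨k, hk, rfl⟩, hdist k hk]
    have hpt : ∀ v k, t v = k + 1 → k ≤ N.G.dist r s ∧ p k = v := by
      intro v k hv
      simp only [t] at hv
      split_ifs at hv with hmem
      obtain ⟨j, hj, rfl⟩ := hmem
      rw [hdist j hj] at hv
      obtain rfl : j = k := by omega
      exact ⟨hj, rfl⟩
    have htD : ∀ v, t v ≤ D + 1 := by
      intro v
      have := hD r v
      simp only [t]
      split_ifs <;> omega
    have hts : t s = N.G.dist r s + 1 := by
      have := htp _ le_rfl
      rwa [hps] at this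
    refine ⟨fun v => mkCert c (N.ids r) (t v), fun v => length_mkCert_le hr (htD v), fun v => ?_⟩
    constructor <;> simp only [certRoot_mkCert hr, certMark_mkCert hr]
    · simp
    · intro hv
      rw [hN v s hv hs, hts]
      omega
    · intro hv
      have h0 := (hpt v 0 hv).2
      have h1 := hdist 0 (Nat.zero_le _)
      rw [h0] at h1
      rw [N.conn.dist_eq_zero_iff.1 h1]
    · intro k hk
      obtain ⟨hk', rfl⟩ := hpt v (k + 1) hk
      exact ⟨p k, (hadj k hk').symm, htp k (by omega)⟩
    · intro _ u w _ _ hu hw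
      rw [← (hpt u _ hu).2, ← (hpt w _ hw).2]
    · intro _ hv u _ hu
      have h1 := (hpt u _ hu).1
      rw [hN v s hv hs, hts] at h1
      omega
  · push Not at hs
    refine ⟨fun v => mkCert c (N.ids r) 0, fun v => length_mkCert_le hr (by omega), fun v => ?_⟩
    constructor <;> simp [certRoot_mkCert hr, certMark_mkCert hr, hs]

/-- If the graph has bounded diameter `D` and contains a vertex whose identifier
is at most a constant `c`, then AMOS can be certified with `O(log D)` bits
(the hidden constant depending only on `c`): there is a 1-local proof-labeling
scheme of size `K · (log D + 1)` on connected graphs of diameter at most `D`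
containing a vertex of identifier at most `c`. -/
theorem amos_small_id_log_diameter (c : ℕ) :
    ∃ K : ℕ, ∀ D : ℕ, 1 ≤ D →
      Nonempty (PLS 1 (fun _ => K * (Nat.log 2 D + 1))
        (fun N => (∀ u v : Fin N.n, N.G.dist u v ≤ D) ∧
          (∃ v : Fin N.n, N.ids v ≤ c))
        Network.AMOS) := by
  classical
  refine ⟨c + 3, fun D _ => ⟨?_⟩⟩
  refine
    { prover := fun N =>
        if h : ∃ P : Fin N.n → List Bool,
            (∀ v, (P v).length ≤ (c + 3) * (Nat.log 2 D + 1)) ∧ ∀ v, LocallyValid c N P v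
        then h.choose else fun _ => []
      verifier := fun N P v => decide (LocallyValid c N P v)
      verifier_local := ?_
      prover_size := ?_
      completeness := ?_
      soundness := ?_ }
  · intro N N' P P' v v' φ hsel hids hP hv
    refine decide_eq_decide.2 ⟨LocallyValid.of_iso φ hsel hids hP hv,
      LocallyValid.of_iso φ.symm ?_ ?_ ?_ ?_⟩
    · intro x
      rw [hsel, φ.apply_symm_apply]
    · intro x
      rw [hids, φ.apply_symm_apply]
    · intro x
      rw [hP, φ.apply_symm_apply]
    · rw [← hv, φ.symm_apply_apply]
  · intro N hN hA v
    have h := exists_certificate N hN.1 hN.2 hA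
    simp only [dif_pos h]
    exact h.choose_spec.1 v
  · intro N hN hA v
    have h := exists_certificate N hN.1 hN.2 hA
    simp only [dif_pos h]
    exact decide_eq_true (h.choose_spec.2 v)
  · intro N _ hA P
    by_contra! hcon
    exact hA (amos_of_locallyValid (c := c) (P := P) fun v => by simpa using hcon v)
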